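/- (Law of large numbers for martingales under a drift function.) Let u be a drift function and α ∈ ℝ₊*. Then for every f ∈ 𝓔^{1+α}_u and every x ∈ 𝐗, (1/n)·Σ_{k=0}^{n−1} (f(X_{k+1}) − Pf(X_k)) → 0 as n → ∞, both ℙ_x-almost everywhere and in L^{1+α}(ℙ_x). -/

import Mathlib

open MeasureTheory Filter Set Topology
open scoped ENNReal NNReal ENat

noncomputable section

/-- The shift on path space. -/
def pshift {X : Type*} (ω : ℕ → X) : ℕ → X := fun n => ω (n + 1)

/-- The natural filtration on path space: the σ-algebra generated by the first `n+1`
coordinates. -/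
def pathFiltration (X : Type*) [MeasurableSpace X] (n : ℕ) : MeasurableSpace (ℕ → X) :=
  MeasurableSpace.comap (fun ω (i : Fin (n + 1)) => ω (i : ℕ)) inferInstance

/-- A Markov chain on `X`, given by the family of its path-space laws `ℙ_x`. -/
structure MarkovChain (X : Type*) [MeasurableSpace X] where
  law : X → Measure (ℕ → X)
  prob : ∀ x, IsProbabilityMeasure (law x)
  meas_law : Measurable law
  start : ∀ x, (law x).map (fun ω => ω 0) = Measure.dirac x
  markov : ∀ (x : X) (n : ℕ) (A : Set (ℕ → X)),
      MeasurableSet[pathFiltration X n] A → ∀ g : (ℕ → X) → ℝ≥0∞, Measurable g →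
      ∫⁻ ω in A, g (fun k => ω (k + n)) ∂law x = ∫⁻ ω in A, ∫⁻ η, g η ∂law (ω n) ∂law x

variable {X : Type*} [MeasurableSpace X]

/-- A stopping time on path space, with values in `ℕ∞`. -/
def IsPathStoppingTime (τ : (ℕ → X) → ℕ∞) : Prop :=
  ∀ n : ℕ, MeasurableSet[pathFiltration X n] {ω | τ ω = (n : ℕ∞)}

/-- `τ` is θ-compatible: `ℙ_x(τ = 0) = 0` and, almost everywhere, `τ ≥ 2` implies
`τ ∘ θ = τ - 1`. -/
def ThetaCompatible (M : MarkovChain X) (τ : (ℕ → X) → ℕ∞) : Prop :=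
  (∀ x, M.law x {ω | τ ω = 0} = 0) ∧
    ∀ x, ∀ᵐ ω ∂M.law x, 2 ≤ τ ω → τ (pshift ω) = τ ω - 1

/-- The Markov operator `P` on nonnegative functions: `Pf(x) = 𝔼_x f(X_1)`. -/
def Pop (M : MarkovChain X) (f : X → ℝ≥0∞) (x : X) : ℝ≥0∞ := ∫⁻ ω, f (ω 1) ∂M.law x

/-- The induced operator `Q`: `Qg(x) = ∫_{τ<∞} g(X_τ) dℙ_x`. -/
def Qop (M : MarkovChain X) (τ : (ℕ → X) → ℕ∞) (g : X → ℝ≥0∞) (x : X) : ℝ≥0∞ :=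
  ∫⁻ ω in {ω | τ ω ≠ ⊤}, g (ω (τ ω).toNat) ∂M.law x

/-- The operator `S`: `Sf(x) = ∫_{τ=1} f(X_1) dℙ_x`. -/
def Sop (M : MarkovChain X) (τ : (ℕ → X) → ℕ∞) (f : X → ℝ≥0∞) (x : X) : ℝ≥0∞ :=
  ∫⁻ ω in {ω | τ ω = 1}, f (ω 1) ∂M.law x

/-- The operator `R`: `Rf(x) = ∫_{τ<∞} (f(X_0) + ⋯ + f(X_{τ-1})) dℙ_x`. -/
def Rop (M : MarkovChain X) (τ : (ℕ → X) → ℕ∞) (f : X → ℝ≥0∞) (x : X) : ℝ≥0∞ :=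
  ∫⁻ ω in {ω | τ ω ≠ ⊤}, ∑ k ∈ Finset.range (τ ω).toNat, f (ω k) ∂M.law x

/-- `𝔼_x τ`, with values in `[0,∞]`. -/
def EtauE (M : MarkovChain X) (τ : (ℕ → X) → ℕ∞) (x : X) : ℝ≥0∞ :=
  ∫⁻ ω, (τ ω : ℝ≥0∞) ∂M.law x

/-- `μ` is `P`-invariant: `∫ Pf dμ = ∫ f dμ` for every bounded nonnegative borelian `f`. -/
def PInvariant (M : MarkovChain X) (μ : Measure X) : Prop :=
  ∀ f : X → ℝ≥0∞, Measurable f → (∃ C : ℝ≥0∞, C ≠ ⊤ ∧ ∀ x, f x ≤ C) →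
    ∫⁻ x, Pop M f x ∂μ = ∫⁻ x, f x ∂μ

/-- `ν` is `Q`-invariant: `∫ Qf dν = ∫ f dν` for every bounded nonnegative borelian `f`. -/
def QInvariant (M : MarkovChain X) (τ : (ℕ → X) → ℕ∞) (ν : Measure X) : Prop :=
  ∀ f : X → ℝ≥0∞, Measurable f → (∃ C : ℝ≥0∞, C ≠ ⊤ ∧ ∀ x, f x ≤ C) →
    ∫⁻ x, Qop M τ f x ∂ν = ∫⁻ x, f x ∂ν

/-- `ν = S*μ`, i.e. `ν(A) = ∫ S𝟙_A dμ` for every borelian `A`. -/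
def SstarEq (M : MarkovChain X) (τ : (ℕ → X) → ℕ∞) (μ ν : Measure X) : Prop :=
  ∀ A : Set X, MeasurableSet A → ν A = ∫⁻ x, Sop M τ (A.indicator 1) x ∂μ

/-- `m = R*ν`, i.e. `m(A) = ∫ R𝟙_A dν` for every borelian `A`. -/
def RstarEq (M : MarkovChain X) (τ : (ℕ → X) → ℕ∞) (ν m : Measure X) : Prop :=
  ∀ A : Set X, MeasurableSet A → m A = ∫⁻ x, Rop M τ (A.indicator 1) x ∂ν

/-- the real-valued Markov operator -/
def Pr (M : MarkovChain X) (f : X → ℝ) (x : X) : ℝ := ∫ ω, f (ω 1) ∂M.law x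

/-- the real-valued induced operator -/
def Qr (M : MarkovChain X) (τ : (ℕ → X) → ℕ∞) (g : X → ℝ) (x : X) : ℝ :=
  ∫ ω in {ω | τ ω ≠ ⊤}, g (ω (τ ω).toNat) ∂M.law x

/-- the real-valued operator `S` -/
def Sr (M : MarkovChain X) (τ : (ℕ → X) → ℕ∞) (f : X → ℝ) (x : X) : ℝ :=
  ∫ ω in {ω | τ ω = 1}, f (ω 1) ∂M.law x

/-- the real-valued operator `R` -/
def Rr (M : MarkovChain X) (τ : (ℕ → X) → ℕ∞) (f : X → ℝ) (x : X) : ℝ :=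
  ∫ ω in {ω | τ ω ≠ ⊤}, ∑ k ∈ Finset.range (τ ω).toNat, f (ω k) ∂M.law x

/-- `𝔼_x τ` as a real number. -/
def Etau (M : MarkovChain X) (τ : (ℕ → X) → ℕ∞) (x : X) : ℝ := (EtauE M τ x).toReal

/-- `B_u = sup (Pu - u) + 1`. -/
def Bu (M : MarkovChain X) (u : X → ℝ) : ℝ :=
  sSup (Set.range fun x => Pr M u x - u x) + 1

/-- the weight `u - Pu + B_u` defining the space `𝓔_u`. -/
def wE (M : MarkovChain X) (u : X → ℝ) : X → ℝ := fun x => u x - Pr M u x + Bu M u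

/-- `u` is a drift function: `u ≥ 1`, `u - Pu` is bounded below and, with
`B_u = sup (Pu - u) + 1`, the functions `Qu`, `𝔼τ/u` and `P(u-Pu+B_u)/(u-Pu+B_u)` are
bounded. -/
structure IsDrift (M : MarkovChain X) (τ : (ℕ → X) → ℕ∞) (u : X → ℝ) : Prop where
  meas : Measurable u
  one_le : ∀ x, 1 ≤ u x
  int_one : ∀ x, Integrable (fun ω => u (ω 1)) (M.law x)
  bdd : BddAbove (Set.range fun x => Pr M u x - u x)
  etau_ne_top : ∀ x, EtauE M τ x ≠ ⊤
  qu_bdd : ∃ C : ℝ, ∀ x, Qr M τ u x ≤ C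
  etau_div_bdd : ∃ C : ℝ, ∀ x, Etau M τ x ≤ C * u x
  pw_bdd : ∃ C : ℝ, ∀ x, Pr M (wE M u) x ≤ C * wE M u x

/-- membership in the weighted space `𝓕^p_v` : `f` is borelian and `|f| ≤ C v^{1/p}`. -/
def MemWp (v : X → ℝ) (p : ℝ) (f : X → ℝ) : Prop :=
  Measurable f ∧ ∃ C : ℝ, ∀ x, |f x| ≤ C * v x ^ (1 / p)

/-- the norm of the weighted space `𝓕^p_v` : `‖f‖ = sup_x |f(x)|/v(x)^{1/p}`. -/
def normWp (v : X → ℝ) (p : ℝ) (f : X → ℝ) : ℝ := ⨆ x, |f x| / v x ^ (1 / p)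

/-- ergodicity among a class of invariant measures: a finite nonzero invariant measure is
ergodic if it is not a nontrivial convex combination of two distinct invariant probability
measures. -/
def ErgodicAmong (Inv : Measure X → Prop) (μ : Measure X) : Prop :=
  μ ≠ 0 ∧ ∀ (ν₁ ν₂ : Measure X) (t : ℝ≥0∞), Inv ν₁ → Inv ν₂ →
    IsProbabilityMeasure ν₁ → IsProbabilityMeasure ν₂ → 0 < t → t < 1 →
    μ = μ Set.univ • (t • ν₁ + (1 - t) • ν₂) → ν₁ = ν₂


lemma aux_ineq_small {p b : ℝ} (hp : 1 < p) (hb : |b| ≤ 1 / p) :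
    |1 + b| ^ p ≤ 1 + p * b + p ^ 2 * b ^ 2 := by
  have hp0 : 0 < p := by linarith
  have h1 : 1 / p < 1 := by rw [div_lt_one hp0]; exact hp
  have hb' := abs_le.1 hb
  have h0 : 0 ≤ 1 + b := by linarith [hb'.1]
  rw [abs_of_nonneg h0]
  have hpb : |p * b| ≤ 1 := by
    rw [abs_mul, abs_of_pos hp0]
    calc p * |b| ≤ p * (1 / p) := by gcongr
      _ = 1 := by field_simp
  have h2 : (1 + b) ^ p ≤ Real.exp (p * b) := by
    have : 1 + b ≤ Real.exp b := by linarith [Real.add_one_le_exp b]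
    calc (1 + b) ^ p ≤ (Real.exp b) ^ p := Real.rpow_le_rpow h0 this hp0.le
      _ = Real.exp (p * b) := by rw [← Real.exp_mul, mul_comm]
  have h3 := Real.abs_exp_sub_one_sub_id_le hpb
  have h4 := (abs_le.1 h3).2
  nlinarith

lemma aux_ineq_large {p b : ℝ} (hp : 1 < p) (hb : 1 / p ≤ |b|) :
    |1 + b| ^ p ≤ 1 + p * b + 2 * (p + 1) ^ p * |b| ^ p := by
  have hp0 : 0 < p := by linarith
  have hpb : 1 ≤ p * |b| := by
    calc (1 : ℝ) = p * (1 / p) := by field_simp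
      _ ≤ p * |b| := by gcongr
  have h1 : |1 + b| ≤ (p + 1) * |b| := by
    have := abs_add_le 1 b
    rw [abs_one] at this
    linarith
  have h2 : |1 + b| ^ p ≤ (p + 1) ^ p * |b| ^ p := by
    rw [← Real.mul_rpow (by linarith) (abs_nonneg b)]
    exact Real.rpow_le_rpow (abs_nonneg _) h1 hp0.le
  have h3 : p * |b| ≤ (p + 1) ^ p * |b| ^ p := by
    rw [← Real.mul_rpow (by linarith) (abs_nonneg b)]
    have : p * |b| ≤ (p + 1) * |b| := by nlinarith [abs_nonneg b]
    refine this.trans ?_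
    exact Real.self_le_rpow_of_one_le (hpb.trans this) hp.le
  have h4 : - (p * |b|) ≤ p * b := by nlinarith [neg_abs_le b]
  linarith

lemma aux_ineqA {p : ℝ} (hp : 1 < p) (hp2 : p ≤ 2) :
    ∃ K : ℝ, 1 ≤ K ∧ ∀ b : ℝ, |1 + b| ^ p ≤ 1 + 0 + p * b + K * |b| ^ p := by
  have hp0 : 0 < p := by linarith
  have hK : 1 ≤ (p + 1) ^ p := Real.one_le_rpow (by linarith) hp0.le
  refine ⟨2 * (p + 1) ^ p, by linarith, fun b => ?_⟩
  rcases le_total |b| (1 / p) with hb | hb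
  · have h := aux_ineq_small hp hb
    have hpb : p * |b| ≤ 1 := by
      calc p * |b| ≤ p * (1 / p) := by gcongr
        _ = 1 := by field_simp
    have h2 : p ^ 2 * b ^ 2 ≤ (p + 1) ^ p * |b| ^ p := by
      have e : p ^ 2 * b ^ 2 = (p * |b|) ^ (2 : ℝ) := by
        rw [Real.rpow_two, mul_pow, sq_abs]
      rw [e, ← Real.mul_rpow (by linarith) (abs_nonneg b)]
      have hn : 0 ≤ p * |b| := by positivity
      calc (p * |b|) ^ (2 : ℝ) ≤ (p * |b|) ^ p :=
            Real.rpow_le_rpow_of_exponent_ge_of_imp hn hpb hp2 (fun _ h => absurd h (by norm_num))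
        _ ≤ _ := Real.rpow_le_rpow hn (by nlinarith [abs_nonneg b]) hp0.le
    have : 0 ≤ (p + 1) ^ p * |b| ^ p := by positivity
    linarith
  · have h := aux_ineq_large hp hb
    linarith

lemma aux_ineqB {p : ℝ} (hp : 2 < p) :
    ∃ C : ℝ, 1 ≤ C ∧ ∀ N : ℝ, 1 ≤ N → ∀ b : ℝ,
      |1 + b| ^ p ≤ 1 + p ^ 2 / N + p * b + C * N ^ ((p - 2) / 2) * |b| ^ p := by
  have hp0 : 0 < p := by linarith
  have hK : 1 ≤ (p + 1) ^ p := Real.one_le_rpow (by linarith) hp0.le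
  refine ⟨p ^ 2 + 2 * (p + 1) ^ p, by nlinarith, fun N hN b => ?_⟩
  have hN0 : 0 < N := by linarith
  have hNg : 1 ≤ N ^ ((p - 2) / 2) := Real.one_le_rpow hN (by linarith)
  have hbp : 0 ≤ |b| ^ p := by positivity
  have hdiv : 0 ≤ p ^ 2 / N := by positivity
  rcases le_total |b| (1 / p) with hb | hb
  · have h := aux_ineq_small (by linarith) hb
    have key : b ^ 2 ≤ 1 / N + N ^ ((p - 2) / 2) * |b| ^ p := by
      rcases le_total (b ^ 2) (1 / N) with h1 | h1
      · have : 0 ≤ N ^ ((p - 2) / 2) * |b| ^ p := by positivity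
        linarith
      · have h2 : 1 ≤ N * b ^ 2 := by
          rw [div_le_iff₀ hN0] at h1; linarith
        have hb0 : b ≠ 0 := by rintro rfl; norm_num at h2
        have h3 : 1 ≤ (N * b ^ 2) ^ ((p - 2) / 2) := Real.one_le_rpow h2 (by linarith)
        have h4 : N ^ ((p - 2) / 2) * |b| ^ p = (N * b ^ 2) ^ ((p - 2) / 2) * b ^ 2 := by
          rw [Real.mul_rpow hN0.le (sq_nonneg b), mul_assoc]
          congr 1
          rw [← sq_abs b, ← Real.rpow_natCast, ← Real.rpow_mul (abs_nonneg b),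
            ← Real.rpow_add (abs_pos.2 hb0)]
          congr 1
          push_cast; ring
        rw [h4]
        have : 0 ≤ 1 / N := by positivity
        nlinarith [sq_nonneg b]
    have h5 : p ^ 2 * b ^ 2 ≤ p ^ 2 / N + p ^ 2 * (N ^ ((p - 2) / 2) * |b| ^ p) := by
      have := mul_le_mul_of_nonneg_left key (sq_nonneg p)
      calc _ ≤ _ := this
        _ = _ := by ring
    have : 0 ≤ 2 * (p + 1) ^ p * (N ^ ((p - 2) / 2) * |b| ^ p) := by positivity
    nlinarith
  · have h := aux_ineq_large (by linarith) hb
    have h6 : 2 * (p + 1) ^ p * |b| ^ p ≤ 2 * (p + 1) ^ p * (N ^ ((p - 2) / 2) * |b| ^ p) := by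
      gcongr
      nlinarith
    have : 0 ≤ p ^ 2 * (N ^ ((p - 2) / 2) * |b| ^ p) := by positivity
    nlinarith

lemma aux_ineqC {p : ℝ} (hp : 1 < p) :
    ∃ C γ : ℝ, 1 ≤ C ∧ 0 ≤ γ ∧ γ < p - 1 ∧ ∀ N : ℝ, 1 ≤ N → ∀ b : ℝ,
      |1 + b| ^ p ≤ 1 + p ^ 2 / N + p * b + C * N ^ γ * |b| ^ p := by
  rcases le_or_gt p 2 with h | h
  · obtain ⟨K, hK, H⟩ := aux_ineqA hp h
    refine ⟨K, 0, hK, le_rfl, by linarith, fun N hN b => ?_⟩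
    have : 0 ≤ p ^ 2 / N := by positivity
    rw [Real.rpow_zero, mul_one]
    linarith [H b]
  · obtain ⟨K, hK, H⟩ := aux_ineqB h
    exact ⟨K, (p - 2) / 2, hK, by linarith, by linarith, H⟩

lemma aux_two {p δ K : ℝ} (hp : 1 < p) (hK : 1 ≤ K)
    (H : ∀ b : ℝ, |1 + b| ^ p ≤ 1 + δ + p * b + K * |b| ^ p) (a b : ℝ) :
    |a + b| ^ p ≤ (1 + δ) * |a| ^ p + p * ((SignType.sign a : ℝ) * |a| ^ (p - 1) * b)
      + K * |b| ^ p := by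
  rcases eq_or_ne a 0 with rfl | ha
  · simp only [zero_add, abs_zero, sign_zero, SignType.coe_zero, zero_mul, mul_zero, add_zero]
    rw [Real.zero_rpow (by linarith)]
    have : 0 ≤ |b| ^ p := by positivity
    nlinarith
  · have hpos : 0 < |a| := abs_pos.2 ha
    have hpp : 0 < |a| ^ p := by positivity
    have h := mul_le_mul_of_nonneg_left (H (b / a)) hpp.le
    have e1 : |a| ^ p * |1 + b / a| ^ p = |a + b| ^ p := by
      rw [← Real.mul_rpow (abs_nonneg _) (abs_nonneg _), ← abs_mul]
      congr 2; field_simp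
    have e2 : |a| ^ p * |b / a| ^ p = |b| ^ p := by
      rw [← Real.mul_rpow (abs_nonneg _) (abs_nonneg _), ← abs_mul]
      congr 2; field_simp
    have e3 : |a| ^ p * (b / a) = (SignType.sign a : ℝ) * |a| ^ (p - 1) * b := by
      rw [Real.rpow_sub_one hpos.ne']
      have : (SignType.sign a : ℝ) * a = |a| := by simp
      have h2 : (SignType.sign a : ℝ) * |a| = a := by simp
      field_simp
      rw [mul_assoc, mul_comm a, this]
    calc |a + b| ^ p = |a| ^ p * |1 + b / a| ^ p := e1.symm
      _ ≤ _ := h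
      _ = (1 + δ) * |a| ^ p + p * (|a| ^ p * (b / a)) + K * (|a| ^ p * |b / a| ^ p) := by ring
      _ = _ := by rw [e2, e3]

lemma abs_add_rpow_le {p : ℝ} (hp : 0 ≤ p) (a b : ℝ) :
    |a + b| ^ p ≤ 2 ^ p * (|a| ^ p + |b| ^ p) := by
  have h : |a + b| ≤ 2 * max |a| |b| := by
    have := abs_add_le a b
    have := le_max_left |a| |b|
    have := le_max_right |a| |b|
    linarith
  have h0 : 0 ≤ max |a| |b| := le_max_of_le_left (abs_nonneg a)
  calc |a + b| ^ p ≤ (2 * max |a| |b|) ^ p := Real.rpow_le_rpow (abs_nonneg _) h hp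
    _ = 2 ^ p * (max |a| |b|) ^ p := Real.mul_rpow (by norm_num) h0
    _ ≤ _ := by
      gcongr
      have h1 : 0 ≤ |a| ^ p := by positivity
      have h2 : 0 ≤ |b| ^ p := by positivity
      rcases max_choice |a| |b| with h | h <;> rw [h] <;> linarith

lemma integrable_of_rpow {Ω : Type*} {m0 : MeasurableSpace Ω} {μ : Measure Ω}
    [IsProbabilityMeasure μ] {p : ℝ} (hp : 1 ≤ p) {D : Ω → ℝ} (hD : AEStronglyMeasurable D μ)
    (h : Integrable (fun ω => |D ω| ^ p) μ) : Integrable D μ := by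
  refine Integrable.mono' ((integrable_const (1 : ℝ)).add h) hD (ae_of_all _ fun ω => ?_)
  have h0 : 0 ≤ |D ω| ^ p := by positivity
  simp only [Pi.add_apply, Real.norm_eq_abs]
  rcases le_total |D ω| 1 with h1 | h1
  · linarith
  · linarith [Real.self_le_rpow_of_one_le h1 hp]

lemma mart_step {Ω : Type*} {m m0 : MeasurableSpace Ω} (hm : m ≤ m0) {μ : Measure Ω}
    [IsProbabilityMeasure μ] {p δ K : ℝ} (hp : 1 < p) (hK : 1 ≤ K)
    (H : ∀ b : ℝ, |1 + b| ^ p ≤ 1 + δ + p * b + K * |b| ^ p) {G D : Ω → ℝ}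
    (hG : StronglyMeasurable[m] G) (hGp : Integrable (fun ω => |G ω| ^ p) μ)
    (hD : AEStronglyMeasurable D μ) (hDp : Integrable (fun ω => |D ω| ^ p) μ)
    (hc : μ[D|m] =ᵐ[μ] 0) :
    Integrable (fun ω => |G ω + D ω| ^ p) μ ∧
    ∫ ω, |G ω + D ω| ^ p ∂μ ≤ (1 + δ) * ∫ ω, |G ω| ^ p ∂μ + K * ∫ ω, |D ω| ^ p ∂μ := by
  have hp0 : 0 < p := by linarith
  have hGm : Measurable[m] G := hG.measurable
  have hG0 : AEStronglyMeasurable G μ := (hG.mono hm).aestronglyMeasurable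
  have hint : Integrable (fun ω => |G ω + D ω| ^ p) μ := by
    refine Integrable.mono' ((hGp.add hDp).const_mul (2 ^ p))
      ((hG0.add hD).aemeasurable.abs.pow_const p).aestronglyMeasurable (ae_of_all _ fun ω => ?_)
    rw [Real.norm_eq_abs, abs_of_nonneg (by positivity)]
    exact abs_add_rpow_le hp0.le _ _
  refine ⟨hint, ?_⟩
  set φ : Ω → ℝ := fun ω => (SignType.sign (G ω) : ℝ) * |G ω| ^ (p - 1) with hφ
  have hsg : Measurable (fun a : ℝ => ((SignType.sign a : SignType) : ℝ)) := by
    have : (fun a : ℝ => ((SignType.sign a : SignType) : ℝ))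
        = fun a => if 0 < a then 1 else if a < 0 then -1 else 0 := by
      ext a
      simp only [sign_apply]
      split_ifs <;> simp
    rw [this]
    exact Measurable.ite measurableSet_Ioi measurable_const
      (Measurable.ite measurableSet_Iio measurable_const measurable_const)
  have hφm : Measurable[m] φ := by
    have h1 : Measurable (fun a : ℝ => ((SignType.sign a : SignType) : ℝ) * |a| ^ (p - 1)) :=
      hsg.mul ((measurable_id.abs).pow_const _)
    exact h1.comp hGm
  have hφb : ∀ ω, |φ ω| ≤ |G ω| ^ (p - 1) := by
    intro ω
    rw [hφ]
    simp only [abs_mul]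
    have h1 : |((SignType.sign (G ω) : SignType) : ℝ)| ≤ 1 := by
      rcases SignType.sign (G ω) with _ | _ | _ <;> simp
    have h2 : 0 ≤ |G ω| ^ (p - 1) := by positivity
    rw [abs_of_nonneg h2]
    nlinarith
  have hφD : Integrable (φ * D) μ := by
    refine Integrable.mono' (hGp.add hDp)
      ((hφm.mono hm le_rfl).aestronglyMeasurable.mul hD) (ae_of_all _ fun ω => ?_)
    simp only [Pi.add_apply, Pi.mul_apply, Real.norm_eq_abs, abs_mul]
    have h1 := mul_le_mul_of_nonneg_right (hφb ω) (abs_nonneg (D ω))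
    refine h1.trans ?_
    have hA : 0 ≤ |G ω| ^ p := by positivity
    have hB : 0 ≤ |D ω| ^ p := by positivity
    have split : ∀ t : ℝ, 0 ≤ t → t ^ (p - 1) * t = t ^ p := by
      intro t ht
      rcases ht.eq_or_lt with rfl | ht
      · rw [mul_zero, Real.zero_rpow hp0.ne']
      · rw [Real.rpow_sub_one ht.ne']; field_simp
    rcases le_total |D ω| |G ω| with h | h
    · have : |G ω| ^ (p - 1) * |D ω| ≤ |G ω| ^ (p - 1) * |G ω| := by gcongr
      rw [split _ (abs_nonneg _)] at this
      linarith
    · have : |G ω| ^ (p - 1) * |D ω| ≤ |D ω| ^ (p - 1) * |D ω| := by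
        gcongr
      rw [split _ (abs_nonneg _)] at this
      linarith
  have hDi : Integrable D μ := integrable_of_rpow hp.le hD hDp
  have hzero : ∫ ω, (φ * D) ω ∂μ = 0 := by
    rw [← integral_condExp hm]
    have h1 := condExp_mul_of_stronglyMeasurable_left hφm.stronglyMeasurable hφD hDi
    have h2 : μ[φ * D|m] =ᵐ[μ] 0 := by
      filter_upwards [h1, hc] with ω e1 e2
      rw [e1, Pi.mul_apply, e2]; simp
    rw [integral_congr_ae h2]; simp
  calc ∫ ω, |G ω + D ω| ^ p ∂μ
      ≤ ∫ ω, ((1 + δ) * |G ω| ^ p + p * (φ * D) ω + K * |D ω| ^ p) ∂μ := by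
        refine integral_mono hint
          (((hGp.const_mul _).add (hφD.const_mul _)).add (hDp.const_mul _)) fun ω => ?_
        exact aux_two hp hK H (G ω) (D ω)
    _ = _ := by
      have i1 : Integrable (fun ω => (1 + δ) * |G ω| ^ p) μ := hGp.const_mul _
      have i2 : Integrable (fun ω => p * (φ * D) ω) μ := hφD.const_mul _
      have i3 : Integrable (fun ω => K * |D ω| ^ p) μ := hDp.const_mul _
      have i4 : Integrable (fun ω => (1 + δ) * |G ω| ^ p + p * (φ * D) ω) μ := i1.add i2
      rw [integral_add i4 i3, integral_add i1 i2, integral_const_mul, integral_const_mul,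
        integral_const_mul, hzero]
      ring

lemma mart_bound {Ω : Type*} {m0 : MeasurableSpace Ω} {μ : Measure Ω}
    [IsProbabilityMeasure μ] (ℱ : Filtration ℕ m0) {p δ K : ℝ} (hp : 1 < p) (hδ : 0 ≤ δ)
    (hK : 1 ≤ K)
    (H : ∀ b : ℝ, |1 + b| ^ p ≤ 1 + δ + p * b + K * |b| ^ p) {D : ℕ → Ω → ℝ}
    (hD : ∀ n, StronglyMeasurable[ℱ (n + 1)] (D n))
    (hDp : ∀ n, Integrable (fun ω => |D n ω| ^ p) μ)
    (hc : ∀ n, μ[D n|ℱ n] =ᵐ[μ] 0) (n : ℕ) :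
    StronglyMeasurable[ℱ n] (fun ω => ∑ k ∈ Finset.range n, D k ω) ∧
    Integrable (fun ω => |∑ k ∈ Finset.range n, D k ω| ^ p) μ ∧
    ∫ ω, |∑ k ∈ Finset.range n, D k ω| ^ p ∂μ ≤
      (1 + δ) ^ n * (K * ∑ k ∈ Finset.range n, ∫ ω, |D k ω| ^ p ∂μ) := by
  induction n with
  | zero =>
    have : p ≠ 0 := by linarith
    simp [Real.zero_rpow this, stronglyMeasurable_const]
  | succ n ih =>
    obtain ⟨h1, h2, h3⟩ := ih
    simp only [Finset.sum_range_succ]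
    obtain ⟨h4, h5⟩ := mart_step (ℱ.le n) hp hK H h1 h2
      ((hD n).mono (ℱ.le _)).aestronglyMeasurable (hDp n) (hc n)
    refine ⟨(h1.mono (ℱ.mono n.le_succ)).add (hD n), h4, h5.trans ?_⟩
    have h6 : 0 ≤ ∫ ω, |D n ω| ^ p ∂μ := integral_nonneg fun ω => by positivity
    have h7 : 1 ≤ (1 + δ) ^ (n + 1) := one_le_pow₀ (by linarith)
    have h8 := mul_le_mul_of_nonneg_left h3 (by linarith : 0 ≤ 1 + δ)
    have h9 : K * ∫ ω, |D n ω| ^ p ∂μ ≤ (1 + δ) ^ (n + 1) * (K * ∫ ω, |D n ω| ^ p ∂μ) := by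
      have : 0 ≤ K * ∫ ω, |D n ω| ^ p ∂μ := by positivity
      nlinarith
    calc _ ≤ _ := add_le_add h8 h9
      _ = _ := by ring

lemma mart_Lp {Ω : Type*} {m0 : MeasurableSpace Ω} {μ : Measure Ω}
    [IsProbabilityMeasure μ] (ℱ : Filtration ℕ m0) {p : ℝ} (hp : 1 < p) {D : ℕ → Ω → ℝ}
    (hD : ∀ n, StronglyMeasurable[ℱ (n + 1)] (D n))
    (hDp : ∀ n, Integrable (fun ω => |D n ω| ^ p) μ)
    (hc : ∀ n, μ[D n|ℱ n] =ᵐ[μ] 0) {A : ℝ}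
    (hA : ∀ n : ℕ, 1 ≤ n → ∑ k ∈ Finset.range n, ∫ ω, |D k ω| ^ p ∂μ ≤ A * n) :
    Tendsto (fun n : ℕ => ∫ ω, |(∑ k ∈ Finset.range n, D k ω) / (n : ℝ)| ^ p ∂μ)
      atTop (𝓝 0) := by
  obtain ⟨C, γ, hC, hγ, hγp, H⟩ := aux_ineqC hp
  have hp0 : 0 < p := by linarith
  have lim : Tendsto (fun n : ℕ => Real.exp (p ^ 2) * C * A * (n : ℝ) ^ (-(p - 1 - γ)))
      atTop (𝓝 0) := by
    have := ((tendsto_rpow_neg_atTop (by linarith : 0 < p - 1 - γ)).comp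
      tendsto_natCast_atTop_atTop).const_mul (Real.exp (p ^ 2) * C * A)
    simpa using this
  refine tendsto_of_tendsto_of_tendsto_of_le_of_le' tendsto_const_nhds lim
    (Eventually.of_forall fun n => integral_nonneg fun ω => by positivity) ?_
  filter_upwards [eventually_ge_atTop 1] with n hn
  have hn1 : (1 : ℝ) ≤ n := by exact_mod_cast hn
  have hn0 : (0 : ℝ) < n := by linarith
  have hng : 1 ≤ (n : ℝ) ^ γ := Real.one_le_rpow hn1 hγ
  obtain ⟨-, -, h3⟩ := mart_bound ℱ (δ := p ^ 2 / n) (K := C * (n : ℝ) ^ γ) hp (by positivity)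
    (by nlinarith) (H n hn1) hD hDp hc n
  have hexp : (1 + p ^ 2 / n) ^ n ≤ Real.exp (p ^ 2) := by
    calc (1 + p ^ 2 / n) ^ n ≤ (Real.exp (p ^ 2 / n)) ^ n := by
          gcongr
          linarith [Real.add_one_le_exp (p ^ 2 / n)]
      _ = Real.exp (p ^ 2) := by
          rw [← Real.exp_nat_mul]; congr 1; field_simp
  have hS : 0 ≤ ∑ k ∈ Finset.range n, ∫ ω, |D k ω| ^ p ∂μ :=
    Finset.sum_nonneg fun k _ => integral_nonneg fun ω => by positivity
  have e : ∀ ω, |(∑ k ∈ Finset.range n, D k ω) / (n : ℝ)| ^ p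
      = (n : ℝ) ^ (-p) * |∑ k ∈ Finset.range n, D k ω| ^ p := by
    intro ω
    rw [abs_div, Real.div_rpow (abs_nonneg _) (abs_nonneg _), Nat.abs_cast,
      Real.rpow_neg hn0.le, div_eq_inv_mul]
  simp_rw [e]
  rw [integral_const_mul]
  have hnp : 0 ≤ (n : ℝ) ^ (-p) := by positivity
  calc _ ≤ (n : ℝ) ^ (-p) * (Real.exp (p ^ 2) * (C * (n : ℝ) ^ γ * (A * n))) := by
        gcongr
        refine h3.trans ?_
        have := hA n hn
        gcongr
    _ = Real.exp (p ^ 2) * C * A * ((n : ℝ) ^ (-p) * (n : ℝ) ^ γ * (n : ℝ) ^ (1 : ℝ)) := by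
        rw [Real.rpow_one]; ring
    _ = _ := by
        rw [← Real.rpow_add hn0, ← Real.rpow_add hn0]
        congr 2; ring

lemma mart_ae {Ω : Type*} {m0 : MeasurableSpace Ω} {μ : Measure Ω}
    [IsProbabilityMeasure μ] (ℱ : Filtration ℕ m0) {p : ℝ} (hp : 1 < p) (hp2 : p ≤ 2)
    {D : ℕ → Ω → ℝ}
    (hD : ∀ n, StronglyMeasurable[ℱ (n + 1)] (D n))
    (hDp : ∀ n, Integrable (fun ω => |D n ω| ^ p) μ)
    (hc : ∀ n, μ[D n|ℱ n] =ᵐ[μ] 0) {A : ℝ}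
    (hA : ∀ n : ℕ, ∑ k ∈ Finset.range n, ((k : ℝ) + 1) ^ (-p) * ∫ ω, |D k ω| ^ p ∂μ ≤ A) :
    ∀ᵐ ω ∂μ, Tendsto (fun n : ℕ => (∑ k ∈ Finset.range n, D k ω) / (n : ℝ))
      atTop (𝓝 0) := by
  obtain ⟨K, hK, H⟩ := aux_ineqA hp hp2
  have hp0 : 0 < p := by linarith
  set E : ℕ → Ω → ℝ := fun n ω => ((n : ℝ) + 1)⁻¹ * D n ω with hE
  have hEm : ∀ n, StronglyMeasurable[ℱ (n + 1)] (E n) := fun n => (hD n).const_mul _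
  have e : ∀ n ω, |E n ω| ^ p = ((n : ℝ) + 1) ^ (-p) * |D n ω| ^ p := by
    intro n ω
    have : (0 : ℝ) < n + 1 := by positivity
    rw [hE]
    simp only [abs_mul]
    rw [Real.mul_rpow (abs_nonneg _) (abs_nonneg _), abs_of_pos (inv_pos.2 this),
      Real.inv_rpow this.le, Real.rpow_neg this.le]
  have hEp : ∀ n, Integrable (fun ω => |E n ω| ^ p) μ := fun n => by
    simp_rw [e]; exact (hDp n).const_mul _
  have hEc : ∀ n, μ[E n|ℱ n] =ᵐ[μ] 0 := fun n => by
    have h1 := condExp_smul (μ := μ) (((n : ℝ) + 1)⁻¹) (D n) (ℱ n)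
    have h2 : E n = ((n : ℝ) + 1)⁻¹ • D n := by ext ω; simp [hE]
    rw [h2]
    filter_upwards [h1, hc n] with ω e1 e2
    rw [e1, Pi.smul_apply, e2]; simp
  have B := mart_bound ℱ hp le_rfl hK H hEm hEp hEc
  set Y : ℕ → Ω → ℝ := fun n ω => ∑ k ∈ Finset.range n, E k ω with hY
  have hYi : ∀ n, Integrable (Y n) μ := fun n =>
    integrable_of_rpow hp.le ((B n).1.mono (ℱ.le n)).aestronglyMeasurable (B n).2.1
  have hmart : Martingale Y ℱ μ := by
    refine martingale_of_condExp_sub_eq_zero_nat (fun n => (B n).1) hYi fun n => ?_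
    have : Y (n + 1) - Y n = E n := by
      ext ω; simp [hY, Finset.sum_range_succ]
    rw [this]; exact hEc n
  have hbdd : ∀ n, eLpNorm (Y n) 1 μ ≤ ((1 + K * A).toNNReal : ℝ≥0∞) := by
    intro n
    rw [eLpNorm_one_eq_lintegral_enorm, ← ofReal_integral_norm_eq_lintegral_enorm (hYi n)]
    refine ENNReal.ofReal_le_ofReal ?_
    calc ∫ ω, ‖Y n ω‖ ∂μ ≤ ∫ ω, (1 + |Y n ω| ^ p) ∂μ := by
          refine integral_mono (hYi n).norm ((integrable_const _).add (B n).2.1) fun ω => ?_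
          have h0 : 0 ≤ |Y n ω| ^ p := by positivity
          simp only [Real.norm_eq_abs]
          rcases le_total |Y n ω| 1 with h1 | h1
          · linarith
          · linarith [Real.self_le_rpow_of_one_le h1 hp.le]
      _ = 1 + ∫ ω, |Y n ω| ^ p ∂μ := by
          rw [integral_add (integrable_const _) (B n).2.1]; simp [hY]
      _ ≤ 1 + K * A := by
          have h := (B n).2.2
          simp_rw [e, integral_const_mul] at h
          rw [add_zero, one_pow, one_mul] at h
          have := hA n
          have h2 := mul_le_mul_of_nonneg_left this (by linarith : 0 ≤ K)
          linarith
  filter_upwards [hmart.submartingale.exists_ae_tendsto_of_bdd hbdd] with ω ⟨c, hcω⟩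
  have h1 := hcω.cesaro
  have h2 := hcω.sub h1
  rw [sub_self] at h2
  refine h2.congr' ?_
  filter_upwards [eventually_ge_atTop 1] with n hn
  have hn0 : (n : ℝ) ≠ 0 := by positivity
  have key : ∀ n : ℕ, ∑ k ∈ Finset.range n, D k ω = n * Y n ω - ∑ k ∈ Finset.range n, Y k ω := by
    intro n
    induction n with
    | zero => simp
    | succ n ih =>
      have hY1 : Y (n + 1) ω = Y n ω + ((n : ℝ) + 1)⁻¹ * D n ω := by
        simp [hY, Finset.sum_range_succ, hE]
      have : (n : ℝ) + 1 ≠ 0 := by positivity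
      rw [Finset.sum_range_succ, Finset.sum_range_succ, ih, hY1]
      push_cast
      field_simp
      ring
  rw [key n]
  field_simp


lemma pathFiltration_coord (n k : ℕ) (hk : k ≤ n) :
    Measurable[pathFiltration X n] (fun ω : ℕ → X => ω k) := by
  have h1 : Measurable[pathFiltration X n]
      (fun (ω : ℕ → X) (i : Fin (n + 1)) => ω (i : ℕ)) := comap_measurable _
  exact (measurable_pi_apply (⟨k, Nat.lt_succ_of_le hk⟩ : Fin (n + 1))).comp h1

/-- the filtration on path space -/
def pFilt (X : Type*) [MeasurableSpace X] :
    Filtration ℕ (inferInstance : MeasurableSpace (ℕ → X)) where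
  seq := pathFiltration X
  mono' := by
    intro i j hij
    refine Measurable.comap_le ?_
    refine @measurable_pi_lambda _ _ _ (pathFiltration X j) _ _ fun a => ?_
    exact pathFiltration_coord j a (by have := a.2; omega)
  le' := fun i => Measurable.comap_le (measurable_pi_lambda _ fun a => measurable_pi_apply _)

lemma meas_Pr (M : MarkovChain X) {h : X → ℝ} (hh : Measurable h) : Measurable (Pr M h) := by
  have h1 : Measurable (fun ω : ℕ → X => h (ω 1)) := hh.comp (measurable_pi_apply 1)
  exact (StronglyMeasurable.integral_kernel
    (κ := (⟨M.law, M.meas_law⟩ : ProbabilityTheory.Kernel X (ℕ → X)))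
    h1.stronglyMeasurable).measurable

lemma lint_transfer (M : MarkovChain X) (x : X) (n : ℕ) {A : Set (ℕ → X)}
    (hA : MeasurableSet[pathFiltration X n] A) {h : X → ℝ} (hh : Measurable h)
    (h0 : ∀ y, 0 ≤ h y) (hi : ∀ y, Integrable (fun ω => h (ω 1)) (M.law y)) :
    ∫⁻ ω in A, ENNReal.ofReal (h (ω (n + 1))) ∂M.law x
      = ∫⁻ ω in A, ENNReal.ofReal (Pr M h (ω n)) ∂M.law x := by
  have hm : Measurable (fun η : ℕ → X => ENNReal.ofReal (h (η 1))) :=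
    (hh.comp (measurable_pi_apply 1)).ennreal_ofReal
  have := M.markov x n A hA _ hm
  simp only [Nat.add_comm 1 n] at this
  rw [this]
  congr 1
  ext ω
  exact (ofReal_integral_eq_lintegral_ofReal (hi _) (ae_of_all _ fun η => h0 _)).symm

lemma Pr_nonneg (M : MarkovChain X) {h : X → ℝ} (h0 : ∀ y, 0 ≤ h y) (y : X) : 0 ≤ Pr M h y :=
  integral_nonneg fun _ => h0 _

lemma meas_coord {h : X → ℝ} (hh : Measurable h) (n : ℕ) :
    Measurable (fun ω : ℕ → X => h (ω n)) := hh.comp (measurable_pi_apply n)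

lemma int_transfer_iff (M : MarkovChain X) (x : X) (n : ℕ) {h : X → ℝ} (hh : Measurable h)
    (h0 : ∀ y, 0 ≤ h y) (hi : ∀ y, Integrable (fun ω => h (ω 1)) (M.law y)) :
    Integrable (fun ω => h (ω (n + 1))) (M.law x) ↔
      Integrable (fun ω => Pr M h (ω n)) (M.law x) := by
  rw [← lintegral_ofReal_ne_top_iff_integrable (meas_coord hh _).aestronglyMeasurable
    (ae_of_all _ fun ω => h0 _),
    ← lintegral_ofReal_ne_top_iff_integrable (meas_coord (meas_Pr M hh) _).aestronglyMeasurable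
    (ae_of_all _ fun ω => Pr_nonneg M h0 _)]
  have := lint_transfer M x n (A := Set.univ) MeasurableSet.univ hh h0 hi
  simp only [Measure.restrict_univ] at this
  rw [this]

lemma int_transfer_nonneg (M : MarkovChain X) (x : X) (n : ℕ) {A : Set (ℕ → X)}
    (hA : MeasurableSet[pathFiltration X n] A) {h : X → ℝ} (hh : Measurable h)
    (h0 : ∀ y, 0 ≤ h y) (hi : ∀ y, Integrable (fun ω => h (ω 1)) (M.law y)) :
    ∫ ω in A, h (ω (n + 1)) ∂M.law x = ∫ ω in A, Pr M h (ω n) ∂M.law x := by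
  rw [integral_eq_lintegral_of_nonneg_ae (ae_of_all _ fun ω => h0 _)
    (meas_coord hh _).aestronglyMeasurable,
    integral_eq_lintegral_of_nonneg_ae (ae_of_all _ fun ω => Pr_nonneg M h0 _)
    (meas_coord (meas_Pr M hh) _).aestronglyMeasurable, lint_transfer M x n hA hh h0 hi]

lemma condExp_diff (M : MarkovChain X) (x : X) (n : ℕ) {h : X → ℝ} (hh : Measurable h)
    (hi : ∀ y, Integrable (fun ω => h (ω 1)) (M.law y))
    (hn : Integrable (fun ω => h (ω (n + 1))) (M.law x)) :
    Integrable (fun ω => h (ω (n + 1)) - Pr M h (ω n)) (M.law x) ∧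
    (M.law x)[fun ω => h (ω (n + 1)) - Pr M h (ω n)|pFilt X n] =ᵐ[M.law x] 0 := by
  have := M.prob x
  set hp : X → ℝ := fun y => max (h y) 0
  set hm : X → ℝ := fun y => max (-h y) 0
  have mp : Measurable hp := hh.max measurable_const
  have mm : Measurable hm := hh.neg.max measurable_const
  have p0 : ∀ y, 0 ≤ hp y := fun y => le_max_right _ _
  have m0 : ∀ y, 0 ≤ hm y := fun y => le_max_right _ _
  have ip : ∀ y, Integrable (fun ω => hp (ω 1)) (M.law y) := fun y => (hi y).pos_part
  have im : ∀ y, Integrable (fun ω => hm (ω 1)) (M.law y) := fun y => (hi y).neg_part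
  have np : Integrable (fun ω => hp (ω (n + 1))) (M.law x) := hn.pos_part
  have nm : Integrable (fun ω => hm (ω (n + 1))) (M.law x) := hn.neg_part
  have e : ∀ y, h y = hp y - hm y := fun y => by
    simp only [hp, hm]
    rcases le_total (h y) 0 with h1 | h1
    · rw [max_eq_right h1, max_eq_left (by linarith)]; ring
    · rw [max_eq_left h1, max_eq_right (by linarith)]; ring
  have eP : ∀ y, Pr M h y = Pr M hp y - Pr M hm y := fun y => by
    unfold Pr
    rw [← integral_sub (ip y) (im y)]
    simp_rw [e]
  have Pp := (int_transfer_iff M x n mp p0 ip).1 np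
  have Pm := (int_transfer_iff M x n mm m0 im).1 nm
  have iP : Integrable (fun ω => Pr M h (ω n)) (M.law x) := by
    simp_rw [eP]; exact Pp.sub Pm
  have hd : Integrable (fun ω => h (ω (n + 1)) - Pr M h (ω n)) (M.law x) := hn.sub iP
  refine ⟨hd, ?_⟩
  refine (ae_eq_condExp_of_forall_setIntegral_eq ((pFilt X).le n) hd
    (fun s _ _ => integrableOn_zero) (fun s hs _ => ?_)
    aestronglyMeasurable_zero).symm
  have hs' : MeasurableSet[pathFiltration X n] s := hs
  rw [integral_sub hn.integrableOn iP.integrableOn]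
  simp_rw [eP]
  rw [integral_sub Pp.integrableOn Pm.integrableOn,
    ← int_transfer_nonneg M x n hs' mp p0 ip, ← int_transfer_nonneg M x n hs' mm m0 im,
    ← integral_sub np.integrableOn nm.integrableOn]
  simp_rw [← e]
  simp

section drift
variable {M : MarkovChain X} {τ : (ℕ → X) → ℕ∞} {u : X → ℝ}

lemma drift_u0 (hu : IsDrift M τ u) (y : X) : 0 ≤ u y := by linarith [hu.one_le y]

lemma drift_w1 (hu : IsDrift M τ u) (y : X) : 1 ≤ wE M u y := by
  have := le_csSup hu.bdd (Set.mem_range_self y)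
  simp only [wE, Bu]
  linarith

lemma drift_wu (hu : IsDrift M τ u) (y : X) : wE M u y ≤ u y + Bu M u := by
  have := Pr_nonneg M (drift_u0 hu) y
  simp only [wE]
  linarith

lemma drift_wm (hu : IsDrift M τ u) : Measurable (wE M u) :=
  (hu.meas.sub (meas_Pr M hu.meas)).add_const _

lemma drift_w_of_u (hu : IsDrift M τ u) (x : X) (n : ℕ)
    (h : Integrable (fun ω => u (ω n)) (M.law x)) :
    Integrable (fun ω => wE M u (ω n)) (M.law x) := by
  have := M.prob x
  refine Integrable.mono' (h.add (integrable_const (Bu M u)))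
    (meas_coord (drift_wm hu) n).aestronglyMeasurable (ae_of_all _ fun ω => ?_)
  rw [Real.norm_eq_abs, abs_of_nonneg (by linarith [drift_w1 hu (ω n)])]
  exact drift_wu hu _

lemma drift_u_int (hu : IsDrift M τ u) (x : X) (n : ℕ) :
    Integrable (fun ω => u (ω n)) (M.law x) := by
  have := M.prob x
  induction n with
  | zero =>
    have h : Integrable u ((M.law x).map (fun ω => ω 0)) := by
      rw [M.start x]
      exact integrable_dirac' hu.meas.stronglyMeasurable enorm_lt_top
    exact h.comp_measurable (measurable_pi_apply 0)
  | succ n ih =>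
    rw [int_transfer_iff M x n hu.meas (drift_u0 hu) hu.int_one]
    refine Integrable.mono' (ih.add (integrable_const (Bu M u)))
      (meas_coord (meas_Pr M hu.meas) n).aestronglyMeasurable (ae_of_all _ fun ω => ?_)
    rw [Real.norm_eq_abs, abs_of_nonneg (Pr_nonneg M (drift_u0 hu) _)]
    have := drift_w1 hu (ω n)
    simp only [wE] at this
    simp only [Pi.add_apply]
    linarith

lemma drift_w_int (hu : IsDrift M τ u) (x : X) (n : ℕ) :
    Integrable (fun ω => wE M u (ω n)) (M.law x) := drift_w_of_u hu x n (drift_u_int hu x n)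

lemma drift_W_eq (hu : IsDrift M τ u) (x : X) (n : ℕ) :
    ∫ ω, wE M u (ω n) ∂M.law x
      = ∫ ω, u (ω n) ∂M.law x - ∫ ω, u (ω (n + 1)) ∂M.law x + Bu M u := by
  have := M.prob x
  have h1 := drift_u_int hu x n
  have h2 := (int_transfer_iff M x n hu.meas (drift_u0 hu) hu.int_one).1 (drift_u_int hu x (n + 1))
  have h3 := int_transfer_nonneg M x n (A := Set.univ) MeasurableSet.univ hu.meas
    (drift_u0 hu) hu.int_one
  simp only [Measure.restrict_univ] at h3
  rw [h3]
  simp only [wE]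
  have h4 : Integrable (fun ω => u (ω n) - Pr M u (ω n)) (M.law x) := h1.sub h2
  rw [integral_add h4 (integrable_const _), integral_sub h1 h2]
  simp

/-- Abel summation against a nonincreasing weight. -/
lemma drift_sum (hu : IsDrift M τ u) (x : X) {b : ℕ → ℝ} (b0 : ∀ n, 0 ≤ b n)
    (hb : ∀ n, b (n + 1) ≤ b n) (n : ℕ) :
    ∑ k ∈ Finset.range n, b k * ∫ ω, wE M u (ω k) ∂M.law x
      ≤ b 0 * ∫ ω, u (ω 0) ∂M.law x + Bu M u * ∑ k ∈ Finset.range n, b k := by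
  have U0 : ∀ n, 0 ≤ ∫ ω, u (ω n) ∂M.law x := fun n => integral_nonneg fun ω => drift_u0 hu _
  have : ∑ k ∈ Finset.range n, b k * ∫ ω, wE M u (ω k) ∂M.law x
      ≤ b 0 * ∫ ω, u (ω 0) ∂M.law x - b n * ∫ ω, u (ω n) ∂M.law x
        + Bu M u * ∑ k ∈ Finset.range n, b k := by
    induction n with
    | zero => simp
    | succ n ih =>
      rw [Finset.sum_range_succ, Finset.sum_range_succ, drift_W_eq hu]
      have := mul_le_mul_of_nonneg_right (hb n) (U0 (n + 1))
      linarith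
  have h2 := mul_nonneg (b0 n) (U0 n)
  linarith

lemma drift_diff (hu : IsDrift M τ u) {p : ℝ} (hp : 1 < p) {f : X → ℝ}
    (hf : MemWp (wE M u) p f) (x : X) :
    (∀ n, StronglyMeasurable[pFilt X (n + 1)] (fun ω : ℕ → X => f (ω (n + 1)) - Pr M f (ω n))) ∧
    (∀ n, Integrable (fun ω : ℕ → X => |f (ω (n + 1)) - Pr M f (ω n)| ^ p) (M.law x)) ∧
    (∀ n, (M.law x)[fun ω : ℕ → X => f (ω (n + 1)) - Pr M f (ω n)|pFilt X n] =ᵐ[M.law x] 0) ∧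
    ∃ A : ℝ, 0 ≤ A ∧ ∀ n, ∫ ω, |f (ω (n + 1)) - Pr M f (ω n)| ^ p ∂M.law x
      ≤ A * ∫ ω, wE M u (ω n) ∂M.law x := by
  obtain ⟨fm, C, hC⟩ := hf
  obtain ⟨L, hL⟩ := hu.pw_bdd
  have hp0 : 0 < p := by linarith
  have w1 := drift_w1 hu
  have w0 : ∀ y, 0 ≤ wE M u y := fun y => by linarith [w1 y]
  have hfp : ∀ y, |f y| ^ p ≤ |C| ^ p * wE M u y := by
    intro y
    have h1 : |f y| ≤ |C| * wE M u y ^ (1 / p) :=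
      (hC y).trans (mul_le_mul_of_nonneg_right (le_abs_self C) (Real.rpow_nonneg (w0 y) _))
    calc |f y| ^ p ≤ (|C| * wE M u y ^ (1 / p)) ^ p :=
          Real.rpow_le_rpow (abs_nonneg _) h1 hp0.le
      _ = |C| ^ p * wE M u y := by
          rw [Real.mul_rpow (abs_nonneg _) (Real.rpow_nonneg (w0 y) _), ← Real.rpow_mul (w0 y),
            one_div_mul_cancel hp0.ne', Real.rpow_one]
  have hfpi : ∀ y n, Integrable (fun ω : ℕ → X => |f (ω n)| ^ p) (M.law y) := by
    intro y n
    refine Integrable.mono' ((drift_w_int hu y n).const_mul (|C| ^ p))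
      ((meas_coord fm n).abs.pow_const p).aestronglyMeasurable (ae_of_all _ fun ω => ?_)
    rw [Real.norm_eq_abs, abs_of_nonneg (by positivity)]
    exact hfp _
  have hfi : ∀ y n, Integrable (fun ω : ℕ → X => f (ω n)) (M.law y) := by
    intro y n
    have := M.prob y
    exact integrable_of_rpow hp.le (meas_coord fm n).aestronglyMeasurable (hfpi y n)
  have hPf : ∀ y, |Pr M f y| ^ p ≤ |C| ^ p * (L * wE M u y) := by
    intro y
    have := M.prob y
    have h1 : |Pr M f y| ≤ ∫ ω, |f (ω 1)| ∂M.law y := abs_integral_le_integral_abs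
    have h2 : (∫ ω, |f (ω 1)| ∂M.law y) ^ p ≤ ∫ ω, |f (ω 1)| ^ p ∂M.law y :=
      (convexOn_rpow hp.le).map_integral_le
        (Real.continuous_rpow_const hp0.le).continuousOn isClosed_Ici
        (ae_of_all _ fun ω => Set.mem_Ici.2 (abs_nonneg _)) (hfi y 1).abs (hfpi y 1)
    calc |Pr M f y| ^ p ≤ (∫ ω, |f (ω 1)| ∂M.law y) ^ p :=
          Real.rpow_le_rpow (abs_nonneg _) h1 hp0.le
      _ ≤ _ := h2
      _ ≤ ∫ ω, |C| ^ p * wE M u (ω 1) ∂M.law y :=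
          integral_mono (hfpi y 1) ((drift_w_int hu y 1).const_mul _) fun ω => hfp _
      _ = |C| ^ p * Pr M (wE M u) y := integral_const_mul _ _
      _ ≤ _ := mul_le_mul_of_nonneg_left (hL y) (by positivity)
  have hpt : ∀ n (ω : ℕ → X), |f (ω (n + 1)) - Pr M f (ω n)| ^ p
      ≤ 2 ^ p * (|C| ^ p * wE M u (ω (n + 1)) + |C| ^ p * (L * wE M u (ω n))) := by
    intro n ω
    have h1 := abs_add_rpow_le hp0.le (f (ω (n + 1))) (-Pr M f (ω n))
    rw [← sub_eq_add_neg, abs_neg] at h1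
    refine h1.trans ?_
    gcongr
    · exact hfp _
    · exact hPf _
  have hdom : ∀ n, Integrable (fun ω : ℕ → X =>
      2 ^ p * (|C| ^ p * wE M u (ω (n + 1)) + |C| ^ p * (L * wE M u (ω n)))) (M.law x) :=
    fun n => (((drift_w_int hu x (n + 1)).const_mul _).add
      (((drift_w_int hu x n).const_mul L).const_mul _)).const_mul _
  have hDi : ∀ n, Integrable (fun ω : ℕ → X => |f (ω (n + 1)) - Pr M f (ω n)| ^ p) (M.law x) := by
    intro n
    refine Integrable.mono' (hdom n)
      (((meas_coord fm (n + 1)).sub (meas_coord (meas_Pr M fm) n)).abs.pow_const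
        p).aestronglyMeasurable (ae_of_all _ fun ω => ?_)
    rw [Real.norm_eq_abs, abs_of_nonneg (by positivity)]
    exact hpt n ω
  have L0 : 0 ≤ L := by
    have h1 := (Pr_nonneg M w0 x).trans (hL x)
    by_contra hneg
    push Not at hneg
    nlinarith [w1 x]
  refine ⟨fun n => ?_, hDi, fun n => (condExp_diff M x n fm (fun y => hfi y 1) (hfi x _)).2,
    2 ^ p * (|C| ^ p * L + |C| ^ p * L), by positivity, fun n => ?_⟩
  · have h1 : Measurable[pathFiltration X (n + 1)] (fun ω : ℕ → X => f (ω (n + 1))) :=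
      fm.comp (pathFiltration_coord _ _ le_rfl)
    have h2 : Measurable[pathFiltration X (n + 1)] (fun ω : ℕ → X => Pr M f (ω n)) :=
      (meas_Pr M fm).comp (pathFiltration_coord _ _ n.le_succ)
    exact (h1.sub h2).stronglyMeasurable
  · have hW : ∫ ω, wE M u (ω (n + 1)) ∂M.law x ≤ L * ∫ ω, wE M u (ω n) ∂M.law x := by
      have hwi := fun y => drift_w_int hu y 1
      have h3 := int_transfer_nonneg M x n (A := Set.univ) MeasurableSet.univ (drift_wm hu) w0 hwi
      simp only [Measure.restrict_univ] at h3
      rw [h3, ← integral_const_mul]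
      exact integral_mono ((int_transfer_iff M x n (drift_wm hu) w0 hwi).1
        (drift_w_int hu x (n + 1))) ((drift_w_int hu x n).const_mul L) fun ω => hL _
    calc _ ≤ ∫ ω, 2 ^ p * (|C| ^ p * wE M u (ω (n + 1)) + |C| ^ p * (L * wE M u (ω n)))
          ∂M.law x := integral_mono (hDi n) (hdom n) (hpt n)
      _ = 2 ^ p * (|C| ^ p * ∫ ω, wE M u (ω (n + 1)) ∂M.law x
            + |C| ^ p * (L * ∫ ω, wE M u (ω n) ∂M.law x)) := by
          rw [integral_const_mul, integral_add ((drift_w_int hu x (n + 1)).const_mul _)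
            (((drift_w_int hu x n).const_mul L).const_mul _), integral_const_mul,
            integral_const_mul, integral_const_mul]
      _ ≤ 2 ^ p * (|C| ^ p * (L * ∫ ω, wE M u (ω n) ∂M.law x)
            + |C| ^ p * (L * ∫ ω, wE M u (ω n) ∂M.law x)) := by gcongr
      _ = _ := by ring

end drift

/-- Proposition 3.3 (law of large numbers for martingales): for a drift function `u`,
`α > 0`, `f ∈ 𝓔^{1+α}_u` and any `x`,
`(1/n) ∑_{k<n} (f(X_{k+1}) - Pf(X_k)) → 0` `ℙ_x`-a.e. and in `L^{1+α}(ℙ_x)`. -/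
theorem stmt12 (M : MarkovChain X) (τ : (ℕ → X) → ℕ∞)
    (hst : IsPathStoppingTime τ) (hθ : ThetaCompatible M τ)
    (u : X → ℝ) (hu : IsDrift M τ u) (α : ℝ) (hα : 0 < α)
    (f : X → ℝ) (hf : MemWp (wE M u) (1 + α) f) (x : X) :
    (∀ᵐ ω ∂M.law x, Tendsto
        (fun n : ℕ => (∑ k ∈ Finset.range n, (f (ω (k + 1)) - Pr M f (ω k))) / (n : ℝ))
        atTop (𝓝 0)) ∧
    Tendsto (fun n : ℕ =>
        ∫ ω, |(∑ k ∈ Finset.range n, (f (ω (k + 1)) - Pr M f (ω k))) / (n : ℝ)| ^ (1 + α)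
          ∂M.law x)
      atTop (𝓝 0) := by
  have := M.prob x
  have w1 := drift_w1 hu
  have hBu : 0 ≤ ∫ ω, u (ω 0) ∂M.law x := integral_nonneg fun ω => drift_u0 hu _
  constructor
  · set q : ℝ := min (1 + α) 2 with hq
    have hq1 : 1 < q := lt_min (by linarith) (by norm_num)
    have hq2 : q ≤ 2 := min_le_right _ _
    have hqp : q ≤ 1 + α := min_le_left _ _
    have hfq : MemWp (wE M u) q f := by
      obtain ⟨fm, C, hC⟩ := hf
      refine ⟨fm, |C|, fun y => (hC y).trans ?_⟩
      have h0 : 0 ≤ wE M u y := by linarith [w1 y]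
      have h1 : wE M u y ^ (1 / (1 + α)) ≤ wE M u y ^ (1 / q) :=
        Real.rpow_le_rpow_of_exponent_le (w1 y)
          (one_div_le_one_div_of_le (by linarith) hqp)
      have h2 : 0 ≤ wE M u y ^ (1 / (1 + α)) := Real.rpow_nonneg h0 _
      calc _ ≤ |C| * wE M u y ^ (1 / (1 + α)) :=
            mul_le_mul_of_nonneg_right (le_abs_self C) h2
        _ ≤ _ := mul_le_mul_of_nonneg_left h1 (abs_nonneg C)
    obtain ⟨hm, hi, hc, A, hA0, hA⟩ := drift_diff hu hq1 hfq x
    have hsum : Summable (fun k : ℕ => ((k : ℝ) + 1) ^ (-q)) := by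
      have h1 : Summable (fun k : ℕ => (k : ℝ) ^ (-q)) := Real.summable_nat_rpow.2 (by linarith)
      have h2 := (summable_nat_add_iff 1).2 h1
      simpa using h2
    have b0 : ∀ k : ℕ, 0 ≤ ((k : ℝ) + 1) ^ (-q) := fun k => by positivity
    have hb : ∀ k : ℕ, (((k + 1 : ℕ) : ℝ) + 1) ^ (-q) ≤ ((k : ℝ) + 1) ^ (-q) := fun k => by
      refine Real.rpow_le_rpow_of_nonpos (by positivity) ?_ (by linarith)
      push_cast; linarith
    refine mart_ae (pFilt X) hq1 hq2 hm hi hc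
      (A := A * ((((0 : ℕ) : ℝ) + 1) ^ (-q) * ∫ ω, u (ω 0) ∂M.law x
        + |Bu M u| * ∑' k : ℕ, ((k : ℝ) + 1) ^ (-q))) fun n => ?_
    have h1 := drift_sum hu x b0 hb n
    calc _ ≤ ∑ k ∈ Finset.range n, A * (((k : ℝ) + 1) ^ (-q) * ∫ ω, wE M u (ω k) ∂M.law x) := by
          refine Finset.sum_le_sum fun k _ => ?_
          have := mul_le_mul_of_nonneg_left (hA k) (b0 k)
          linarith
      _ = A * ∑ k ∈ Finset.range n, ((k : ℝ) + 1) ^ (-q) * ∫ ω, wE M u (ω k) ∂M.law x := by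
          rw [Finset.mul_sum]
      _ ≤ _ := by
          refine mul_le_mul_of_nonneg_left (h1.trans ?_) hA0
          have h2 := hsum.sum_le_tsum (Finset.range n) fun k _ => b0 k
          have h3 : 0 ≤ ∑ k ∈ Finset.range n, ((k : ℝ) + 1) ^ (-q) :=
            Finset.sum_nonneg fun k _ => b0 k
          have h4 := mul_le_mul_of_nonneg_right (le_abs_self (Bu M u)) h3
          have h5 := mul_le_mul_of_nonneg_left h2 (abs_nonneg (Bu M u))
          linarith
  · obtain ⟨hm, hi, hc, A, hA0, hA⟩ := drift_diff hu (by linarith : 1 < 1 + α) hf x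
    refine mart_Lp (pFilt X) (by linarith) hm hi hc
      (A := A * (∫ ω, u (ω 0) ∂M.law x + Bu M u)) fun n hn => ?_
    have h1 := drift_sum hu x (b := fun _ => 1) (fun _ => zero_le_one) (fun _ => le_rfl) n
    simp only [one_mul, Finset.sum_const, Finset.card_range, nsmul_eq_mul, mul_one] at h1
    have hn1 : (1 : ℝ) ≤ n := by exact_mod_cast hn
    calc _ ≤ ∑ k ∈ Finset.range n, A * ∫ ω, wE M u (ω k) ∂M.law x :=
          Finset.sum_le_sum fun k _ => hA k
      _ = A * ∑ k ∈ Finset.range n, ∫ ω, wE M u (ω k) ∂M.law x := by rw [Finset.mul_sum]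
      _ ≤ A * ((∫ ω, u (ω 0) ∂M.law x) * n + Bu M u * n) := by
          refine mul_le_mul_of_nonneg_left (h1.trans ?_) hA0
          nlinarith
      _ = _ := by ring

end
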